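/- Let R be a graded commutative 2-ring, let S be a homogeneous multiplicative system in R, and let F : R → A be an R-algebra, i.e. an additive symmetric monoidal functor from R to an essentially small preadditive symmetric monoidal category A whose tensor product is additive in each variable. Let S_A be the smallest class of morphisms of A containing F(S) and all isomorphisms of A and closed under composition and under tensoring with identity morphisms of objects of A. Then S_A satisfies both a left and a right calculus of fractions in A. -/

import Mathlib

open CategoryTheory CategoryTheory.Limits CategoryTheory.MonoidalCategory

universe w v u v' u' v'' u''

/-- A *graded commutative 2-ring*: an essentially small preadditive symmetric monoidal
category whose tensor product is additive in each variable and in which every object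
is invertible for the tensor product. -/
class GradedComm2Ring (C : Type u) [Category.{v} C] [Preadditive C] [MonoidalCategory C]
    [SymmetricCategory C] [MonoidalPreadditive C] : Prop where
  essentiallySmall : EssentiallySmall.{v} C
  invertible : ∀ g : C, ∃ g' : C, Nonempty (g ⊗ g' ≅ 𝟙_ C)
section TranslateDef

variable {C : Type u} [Category.{v} C] [MonoidalCategory C]

/-- `Translate r r'` says that `r'` is a *translate* of `r`: it is obtained from `r`
by a finite sequence of the operations of tensoring with an identity morphism
(on either side) and of composing with an isomorphism (on either side). -/
inductive Translate : ∀ {g h g' h' : C}, (g ⟶ h) → (g' ⟶ h') → Prop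
  | refl {g h : C} (r : g ⟶ h) : Translate r r
  | whiskerLeft {g h g' h' : C} {r : g ⟶ h} {r' : g' ⟶ h'} (ℓ : C) :
      Translate r r' → Translate r (ℓ ◁ r')
  | whiskerRight {g h g' h' : C} {r : g ⟶ h} {r' : g' ⟶ h'} (ℓ : C) :
      Translate r r' → Translate r (r' ▷ ℓ)
  | compIsoLeft {g h g' h' h'' : C} {r : g ⟶ h} {r' : g' ⟶ h'} (u : h' ≅ h'') :
      Translate r r' → Translate r (r' ≫ u.hom)
  | compIsoRight {g h g' h' g'' : C} {r : g ⟶ h} {r' : g' ⟶ h'} (u : g'' ≅ g') :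
      Translate r r' → Translate r (u.hom ≫ r')

end TranslateDef
section MulSysDef

variable {C : Type u} [Category.{v} C] [MonoidalCategory C]

/-- A *homogeneous multiplicative system*: a class of morphisms containing all
isomorphisms and closed under composition and under taking translates. -/
structure IsHomMulSystem (S : MorphismProperty C) : Prop where
  iso_mem : ∀ {g h : C} (f : g ⟶ h), IsIso f → S f
  comp_mem : ∀ {g h l : C} (f : g ⟶ h) (f' : h ⟶ l), S f → S f' → S (f ≫ f')
  translate_mem : ∀ {g h g' h' : C} (f : g ⟶ h) (f' : g' ⟶ h'),
      S f → Translate f f' → S f'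

end MulSysDef
section ExtDef

variable {C : Type u} [Category.{v} C] [MonoidalCategory C]
  {A : Type u'} [Category.{v'} A] [MonoidalCategory A]

/-- The smallest class of morphisms of `A` containing the image `F(S)`, containing all
isomorphisms of `A`, and closed under composition and under tensoring with identity
morphisms of objects of `A`. -/
inductive ExtMem (F : C ⥤ A) (S : MorphismProperty C) : ∀ {x y : A}, (x ⟶ y) → Prop
  | of {g h : C} (s : g ⟶ h) : S s → ExtMem F S (F.map s)
  | iso {x y : A} (f : x ⟶ y) : IsIso f → ExtMem F S f
  | comp {x y z : A} (f : x ⟶ y) (g : y ⟶ z) :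
      ExtMem F S f → ExtMem F S g → ExtMem F S (f ≫ g)
  | whiskerLeft {x y : A} (z : A) (f : x ⟶ y) : ExtMem F S f → ExtMem F S (z ◁ f)
  | whiskerRight {x y : A} (z : A) (f : x ⟶ y) : ExtMem F S f → ExtMem F S (f ▷ z)

/-- The extension `S_A` of a multiplicative system `S` of `C` along `F : C ⥤ A`. -/
def extSystem (F : C ⥤ A) (S : MorphismProperty C) : MorphismProperty A :=
  fun _ _ f => ExtMem F S f

end ExtDef

set_option linter.unusedSectionVars false
section Helpers

variable {D : Type u} [Category.{v} D] [MonoidalCategory D] [SymmetricCategory D]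

noncomputable def invEqv (g g' : D) (e : g ⊗ g' ≅ 𝟙_ D) : D ≌ D :=
  CategoryTheory.Equivalence.mk (tensorLeft g) (tensorLeft g')
    (NatIso.ofComponents
      (fun x => (λ_ x).symm ≪≫ whiskerRightIso (e.symm ≪≫ β_ g g') x ≪≫ α_ g' g x)
      (by
        intro x y f
        simp only [Iso.trans_hom, Iso.symm_hom, whiskerRightIso_hom, Category.assoc]
        change f ≫ (λ_ y).inv ≫ (e.inv ≫ (β_ g g').hom) ▷ y ≫ (α_ g' g y).hom =
          (λ_ x).inv ≫ (e.inv ≫ (β_ g g').hom) ▷ x ≫ (α_ g' g x).hom ≫ g' ◁ g ◁ f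
        rw [leftUnitor_inv_naturality_assoc, whisker_exchange_assoc, tensor_whiskerLeft]
        simp))
    (NatIso.ofComponents
      (fun x => (α_ g g' x).symm ≪≫ whiskerRightIso e x ≪≫ λ_ x)
      (by
        intro x y f
        simp only [Iso.trans_hom, Iso.symm_hom, whiskerRightIso_hom, Category.assoc]
        change g ◁ g' ◁ f ≫ (α_ g g' y).inv ≫ e.hom ▷ y ≫ (λ_ y).hom =
          (α_ g g' x).inv ≫ e.hom ▷ x ≫ (λ_ x).hom ≫ f
        rw [← leftUnitor_naturality, ← whisker_exchange_assoc, tensor_whiskerLeft]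
        simp))

lemma inv_full (g g' : D) (e : g ⊗ g' ≅ 𝟙_ D) {x y : D} (f : g ⊗ x ⟶ g ⊗ y) :
    ∃ t : x ⟶ y, f = g ◁ t := by
  have h : (tensorLeft g).Full := (invEqv g g' e).full_functor
  obtain ⟨t, ht⟩ := h.map_surjective f
  exact ⟨t, ht.symm⟩

lemma swap_left (k k' : D) (e : k ⊗ k' ≅ 𝟙_ D) (s : 𝟙_ D ⟶ k) :
    ∃ c : k ⟶ k, (ρ_ k).inv ≫ k ◁ s = c ≫ (λ_ k).inv ≫ s ▷ k := by
  obtain ⟨w, hw⟩ := inv_full k k' e (β_ k k).hom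
  have h4 : k ◁ s = (β_ k (𝟙_ D)).hom ≫ s ▷ k ≫ (β_ k k).hom := by simp
  have h5 : s ▷ k ≫ k ◁ w = (𝟙_ D) ◁ w ≫ s ▷ k := (whisker_exchange _ _).symm
  refine ⟨w, ?_⟩
  rw [h4, hw, h5]
  simp

lemma swap_right (k k' : D) (e : k ⊗ k' ≅ 𝟙_ D) (s : k ⟶ 𝟙_ D) :
    ∃ c : k ⟶ k, k ◁ s ≫ (ρ_ k).hom = s ▷ k ≫ (λ_ k).hom ≫ c := by
  obtain ⟨w, hw⟩ := inv_full k k' e (β_ k k).hom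
  have h4 : k ◁ s = (β_ k k).hom ≫ s ▷ k ≫ (β_ (𝟙_ D) k).hom := by
    rw [BraidedCategory.braiding_naturality_left, SymmetricCategory.symmetry_assoc]
  have h5 : k ◁ w ≫ s ▷ k = s ▷ k ≫ (𝟙_ D) ◁ w := (whisker_exchange _ _)
  refine ⟨w, ?_⟩
  rw [h4, hw]
  simp only [Category.assoc]
  rw [reassoc_of% h5]
  simp

lemma IsHomMulSystem.reflect {S : MorphismProperty D} (hS : IsHomMulSystem S)
    (g g' : D) (e : g ⊗ g' ≅ 𝟙_ D) {x y : D} (t : x ⟶ y) (h : S (g ◁ t)) : S t := by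
  have h1 := hS.translate_mem _ _ h
    ((((Translate.refl (g ◁ t)).whiskerLeft g').compIsoLeft
      ((invEqv g g' e).unitIso.app y).symm).compIsoRight ((invEqv g g' e).unitIso.app x))
  have n := (invEqv g g' e).unitIso.hom.naturality t
  have h2 := (Iso.eq_comp_inv ((invEqv g g' e).unitIso.app y)).2 n
  have h3 : t = _ := h2.trans (Category.assoc _ _ _)
  rw [h3]
  exact h1

lemma IsHomMulSystem.comp_iso {S : MorphismProperty D} (hS : IsHomMulSystem S)
    {x y z : D} (t : x ⟶ y) (e : y ≅ z) (h : S t) : S (t ≫ e.hom) :=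
  hS.translate_mem _ _ h ((Translate.refl t).compIsoLeft e)

lemma IsHomMulSystem.iso_comp {S : MorphismProperty D} (hS : IsHomMulSystem S)
    {x y z : D} (t : y ⟶ z) (e : x ≅ y) (h : S t) : S (e.hom ≫ t) :=
  hS.translate_mem _ _ h ((Translate.refl t).compIsoRight e)

end Helpers

section Main

open Functor.LaxMonoidal Functor.OplaxMonoidal Functor.Monoidal

variable {C : Type u} [Category.{v} C] [MonoidalCategory C] [SymmetricCategory C]
    {A : Type u'} [Category.{v'} A] [MonoidalCategory A] [SymmetricCategory A]
    (F : C ⥤ A) [F.Monoidal] (S : MorphismProperty C)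

def sig {K : A} (p : 𝟙_ A ⟶ K) (x : A) : x ⟶ x ⊗ K := (ρ_ x).inv ≫ x ◁ p
def tau {K : A} (p : K ⟶ 𝟙_ A) (x : A) : x ⊗ K ⟶ x := x ◁ p ≫ (ρ_ x).hom

lemma sig_nat {K : A} (p : 𝟙_ A ⟶ K) {x y : A} (f : x ⟶ y) :
    f ≫ sig p y = sig p x ≫ f ▷ K := by
  simp only [sig, Category.assoc]
  rw [rightUnitor_inv_naturality_assoc, whisker_exchange]

lemma tau_nat {K : A} (p : K ⟶ 𝟙_ A) {x y : A} (f : x ⟶ y) :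
    tau p x ≫ f = f ▷ K ≫ tau p y := by
  simp only [tau, Category.assoc]
  rw [← rightUnitor_naturality, whisker_exchange_assoc]

lemma sig_swap {K K' : A} (e : K ⊗ K' ≅ 𝟙_ A) (p : 𝟙_ A ⟶ K) (x : A) :
    ∃ c : x ⊗ K ⟶ x ⊗ K, sig p (x ⊗ K) = c ≫ sig p x ▷ K := by
  obtain ⟨c, hc⟩ := swap_left K K' e p
  refine ⟨x ◁ c, ?_⟩
  have := congrArg (fun q => x ◁ q ≫ (α_ x K K).inv) hc
  simp only [MonoidalCategory.whiskerLeft_comp, Category.assoc] at this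
  simp only [sig]
  refine Eq.trans ?_ (this.trans ?_)
  · simp
  · simp

lemma tau_swap {K K' : A} (e : K ⊗ K' ≅ 𝟙_ A) (p : K ⟶ 𝟙_ A) (x : A) :
    ∃ c : x ⊗ K ⟶ x ⊗ K, tau p (x ⊗ K) = tau p x ▷ K ≫ c := by
  obtain ⟨c, hc⟩ := swap_right K K' e p
  refine ⟨x ◁ c, ?_⟩
  have := congrArg (fun q => (α_ x K K).hom ≫ x ◁ q) hc
  simp only [MonoidalCategory.whiskerLeft_comp] at this
  simp only [tau]
  refine Eq.trans ?_ (this.trans ?_)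
  · simp
  · simp

def TL {x y : A} (f : x ⟶ y) : Prop :=
  ∃ (k : C) (s : 𝟙_ C ⟶ k) (_ : S s) (e : x ⊗ F.obj k ≅ y),
    f = sig (ε F ≫ F.map s) x ≫ e.hom

def TR {x y : A} (f : x ⟶ y) : Prop :=
  ∃ (k : C) (s : k ⟶ 𝟙_ C) (_ : S s) (e : x ≅ y ⊗ F.obj k),
    f = e.hom ≫ tau (F.map s ≫ η F) y

variable {S}

lemma ext_sig {k : C} (s : 𝟙_ C ⟶ k) (hs : S s) (x : A) :
    extSystem F S (sig (ε F ≫ F.map s) x) :=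
  .comp _ _ (.iso _ inferInstance) (.whiskerLeft _ _ (.comp _ _ (.iso _ inferInstance) (.of s hs)))

lemma ext_tau {k : C} (s : k ⟶ 𝟙_ C) (hs : S s) (x : A) :
    extSystem F S (tau (F.map s ≫ η F) x) :=
  .comp _ _ (.whiskerLeft _ _ (.comp _ _ (.of s hs) (.iso _ inferInstance))) (.iso _ inferInstance)

lemma TL_iso (hS : IsHomMulSystem S) {x y : A} (f : x ⟶ y) (hf : IsIso f) : TL F S f := by
  refine ⟨𝟙_ C, 𝟙 _, hS.iso_mem _ inferInstance,
    whiskerLeftIso x (εIso F).symm ≪≫ ρ_ x ≪≫ asIso f, ?_⟩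
  simp [sig, ← MonoidalCategory.whiskerLeft_comp_assoc]

lemma TR_iso (hS : IsHomMulSystem S) {x y : A} (f : x ⟶ y) (hf : IsIso f) : TR F S f := by
  refine ⟨𝟙_ C, 𝟙 _, hS.iso_mem _ inferInstance,
    asIso f ≪≫ (ρ_ y).symm ≪≫ whiskerLeftIso y (εIso F), ?_⟩
  simp [tau, ← MonoidalCategory.whiskerLeft_comp_assoc]

lemma TL_comp (hS : IsHomMulSystem S) {x y z : A} (f : x ⟶ y) (g : y ⟶ z)
    (hf : TL F S f) (hg : TL F S g) : TL F S (f ≫ g) := by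
  obtain ⟨k, s, hs, e, rfl⟩ := hf
  obtain ⟨k', s', hs', e', rfl⟩ := hg
  refine ⟨k ⊗ k', s ≫ (ρ_ k).inv ≫ k ◁ s', ?_,
    whiskerLeftIso x (μIso F k k').symm ≪≫ (α_ x (F.obj k) (F.obj k')).symm ≪≫
      whiskerRightIso e (F.obj k') ≪≫ e', ?_⟩
  · exact hS.comp_mem _ _ hs (hS.iso_comp _ (ρ_ k).symm
      (hS.translate_mem _ _ hs' ((Translate.refl s').whiskerLeft k)))
  · have key : sig (ε F ≫ F.map (s ≫ (ρ_ k).inv ≫ k ◁ s')) x ≫ x ◁ δ F k k' =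
        sig (ε F ≫ F.map s) x ≫ sig (ε F ≫ F.map s') (x ⊗ F.obj k) ≫ (α_ _ _ _).hom := by
      have hb : F.map (ρ_ k).inv ≫ F.map (k ◁ s') ≫ δ F k k' =
          (ρ_ (F.obj k)).inv ≫ F.obj k ◁ (ε F ≫ F.map s') := by
        rw [Functor.Monoidal.map_whiskerLeft, Functor.Monoidal.map_rightUnitor_inv]
        simp
      have hb' := congrArg (fun q => x ◁ q) hb
      simp only [MonoidalCategory.whiskerLeft_comp] at hb'
      simp only [sig, Category.assoc, MonoidalCategory.whiskerLeft_comp, Functor.map_comp, hb']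
      simp only [tensor_whiskerLeft, Category.assoc, Iso.inv_hom_id, Category.comp_id,
        rightUnitor_tensor_inv, Iso.inv_hom_id_assoc]
    rw [Category.assoc, ← Category.assoc e.hom, sig_nat]
    simp only [Iso.trans_hom, whiskerLeftIso_hom, Iso.symm_hom, μIso_inv, whiskerRightIso_hom,
      reassoc_of% key]
    simp

lemma TR_comp (hS : IsHomMulSystem S) {x y z : A} (f : x ⟶ y) (g : y ⟶ z)
    (hf : TR F S f) (hg : TR F S g) : TR F S (f ≫ g) := by
  obtain ⟨k, s, hs, e, rfl⟩ := hf
  obtain ⟨k', s', hs', e', rfl⟩ := hg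
  refine ⟨k' ⊗ k, k' ◁ s ≫ (ρ_ k').hom ≫ s', ?_,
    e ≪≫ whiskerRightIso e' (F.obj k) ≪≫ α_ z (F.obj k') (F.obj k) ≪≫
      whiskerLeftIso z (μIso F k' k), ?_⟩
  · rw [← Category.assoc]
    exact hS.comp_mem _ _ (hS.comp_iso _ (ρ_ k')
      (hS.translate_mem _ _ hs ((Translate.refl s).whiskerLeft k'))) hs'
  · have key : z ◁ μ F k' k ≫ tau (F.map (k' ◁ s ≫ (ρ_ k').hom ≫ s') ≫ η F) z =
        (α_ _ _ _).inv ≫ tau (F.map s ≫ η F) (z ⊗ F.obj k') ≫ tau (F.map s' ≫ η F) z := by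
      have hb : μ F k' k ≫ F.map (k' ◁ s) ≫ F.map (ρ_ k').hom =
          F.obj k' ◁ (F.map s ≫ η F) ≫ (ρ_ (F.obj k')).hom := by
        rw [Functor.Monoidal.map_whiskerLeft, Functor.Monoidal.map_rightUnitor]
        simp
      have hb' := congrArg (fun q => z ◁ q) hb
      simp only [MonoidalCategory.whiskerLeft_comp] at hb'
      simp only [tau, Category.assoc, MonoidalCategory.whiskerLeft_comp, Functor.map_comp,
        reassoc_of% hb']
      simp only [tensor_whiskerLeft, Category.assoc, Iso.inv_hom_id_assoc,
        rightUnitor_tensor_hom]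
    rw [Category.assoc, ← Category.assoc (tau _ _), tau_nat]
    simp only [Iso.trans_hom, whiskerLeftIso_hom, μIso_hom, whiskerRightIso_hom, Category.assoc,
      key]
    simp

lemma TL_whiskerLeft {x y : A} (z : A) (f : x ⟶ y) (hf : TL F S f) : TL F S (z ◁ f) := by
  obtain ⟨k, s, hs, e, rfl⟩ := hf
  refine ⟨k, s, hs, α_ _ _ _ ≪≫ whiskerLeftIso z e, ?_⟩
  simp [sig]

lemma TR_whiskerLeft {x y : A} (z : A) (f : x ⟶ y) (hf : TR F S f) : TR F S (z ◁ f) := by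
  obtain ⟨k, s, hs, e, rfl⟩ := hf
  refine ⟨k, s, hs, whiskerLeftIso z e ≪≫ (α_ _ _ _).symm, ?_⟩
  simp [tau]

lemma TL_of (hC : ∀ g : C, ∃ g' : C, Nonempty (g ⊗ g' ≅ 𝟙_ C)) (hS : IsHomMulSystem S)
    {g h : C} (s : g ⟶ h) (hs : S s) : TL F S (F.map s) := by
  obtain ⟨g', ⟨i⟩⟩ := hC g
  let e : g ⊗ (g' ⊗ h) ≅ h := (α_ _ _ _).symm ≪≫ whiskerRightIso i h ≪≫ λ_ h
  obtain ⟨t, ht⟩ := inv_full g g' i ((ρ_ g).hom ≫ s ≫ e.symm.hom)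
  refine ⟨_, t, hS.reflect g g' i t ?_, μIso F _ _ ≪≫ F.mapIso e, ?_⟩
  · rw [← ht]
    exact hS.iso_comp _ _ (hS.comp_iso _ _ hs)
  · have h1 : s = (ρ_ g).inv ≫ g ◁ t ≫ e.hom := by simp [← ht]
    rw [h1]
    simp only [Functor.map_comp, Functor.Monoidal.map_whiskerLeft,
      Functor.Monoidal.map_rightUnitor_inv, sig]
    simp

lemma TR_of (hC : ∀ g : C, ∃ g' : C, Nonempty (g ⊗ g' ≅ 𝟙_ C)) (hS : IsHomMulSystem S)
    {g h : C} (s : g ⟶ h) (hs : S s) : TR F S (F.map s) := by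
  obtain ⟨h', ⟨i⟩⟩ := hC h
  let e : h ⊗ (h' ⊗ g) ≅ g := (α_ _ _ _).symm ≪≫ whiskerRightIso i g ≪≫ λ_ g
  obtain ⟨t, ht⟩ := inv_full h h' i (e.hom ≫ s ≫ (ρ_ h).symm.hom)
  refine ⟨_, t, hS.reflect h h' i t ?_, F.mapIso e.symm ≪≫ (μIso F _ _).symm, ?_⟩
  · rw [← ht]
    exact hS.iso_comp _ _ (hS.comp_iso _ _ hs)
  · have h1 : s = e.inv ≫ h ◁ t ≫ (ρ_ h).hom := by simp [← ht]
    rw [h1]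
    simp only [Functor.map_comp, Functor.Monoidal.map_whiskerLeft,
      Functor.Monoidal.map_rightUnitor, tau]
    simp

lemma ext_TL (hC : ∀ g : C, ∃ g' : C, Nonempty (g ⊗ g' ≅ 𝟙_ C)) (hS : IsHomMulSystem S)
    {x y : A} (f : x ⟶ y) (hf : extSystem F S f) : TL F S f := by
  change ExtMem F S f at hf
  induction hf with
  | of s hs => exact TL_of F hC hS s hs
  | iso f hf => exact TL_iso F hS f hf
  | comp f g _ _ h1 h2 => exact TL_comp F hS f g h1 h2
  | whiskerLeft z f _ h => exact TL_whiskerLeft F z f h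
  | @whiskerRight x y z f _ h =>
    have : f ▷ z = (β_ x z).hom ≫ z ◁ f ≫ (β_ z y).hom := by simp
    rw [this]
    exact TL_comp F hS _ _ (TL_iso F hS _ inferInstance)
      (TL_comp F hS _ _ (TL_whiskerLeft F z f h) (TL_iso F hS _ inferInstance))

lemma ext_TR (hC : ∀ g : C, ∃ g' : C, Nonempty (g ⊗ g' ≅ 𝟙_ C)) (hS : IsHomMulSystem S)
    {x y : A} (f : x ⟶ y) (hf : extSystem F S f) : TR F S f := by
  change ExtMem F S f at hf
  induction hf with
  | of s hs => exact TR_of F hC hS s hs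
  | iso f hf => exact TR_iso F hS f hf
  | comp f g _ _ h1 h2 => exact TR_comp F hS f g h1 h2
  | whiskerLeft z f _ h => exact TR_whiskerLeft F z f h
  | @whiskerRight x y z f _ h =>
    have : f ▷ z = (β_ x z).hom ≫ z ◁ f ≫ (β_ z y).hom := by simp
    rw [this]
    exact TR_comp F hS _ _ (TR_iso F hS _ inferInstance)
      (TR_comp F hS _ _ (TR_whiskerLeft F z f h) (TR_iso F hS _ inferInstance))

lemma inv_obj (hC : ∀ g : C, ∃ g' : C, Nonempty (g ⊗ g' ≅ 𝟙_ C)) (k : C) :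
    ∃ K' : A, Nonempty (F.obj k ⊗ K' ≅ 𝟙_ A) := by
  obtain ⟨k', ⟨i⟩⟩ := hC k
  exact ⟨F.obj k', ⟨μIso F k k' ≪≫ F.mapIso i ≪≫ (εIso F).symm⟩⟩

lemma ext_mult : (extSystem F S).IsMultiplicative where
  id_mem _ := .iso _ inferInstance
  comp_mem _ _ h1 h2 := .comp _ _ h1 h2

lemma ext_left (hC : ∀ g : C, ∃ g' : C, Nonempty (g ⊗ g' ≅ 𝟙_ C)) (hS : IsHomMulSystem S) :
    (extSystem F S).HasLeftCalculusOfFractions where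
  toIsMultiplicative := ext_mult F
  exists_leftFraction X Y p := by
    obtain ⟨q, hq, f⟩ := p
    obtain ⟨k, s, hs, e, rfl⟩ := ext_TL F hC hS q hq
    refine ⟨⟨e.inv ≫ f ▷ F.obj k, sig (ε F ≫ F.map s) Y, ext_sig F s hs Y⟩, ?_⟩
    simp [sig_nat]
  ext X' X Y f₁ f₂ q hq h := by
    obtain ⟨k, s, hs, e, rfl⟩ := ext_TL F hC hS q hq
    refine ⟨_, sig (ε F ≫ F.map s) Y, ext_sig F s hs Y, ?_⟩
    obtain ⟨K', ⟨i⟩⟩ := inv_obj F hC k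
    obtain ⟨c, hc⟩ := sig_swap i (ε F ≫ F.map s) X'
    rw [← cancel_epi e.hom, ← Category.assoc, ← Category.assoc, sig_nat, sig_nat, hc]
    simp only [Category.assoc, ← comp_whiskerRight] at h ⊢
    rw [h]

lemma ext_right (hC : ∀ g : C, ∃ g' : C, Nonempty (g ⊗ g' ≅ 𝟙_ C)) (hS : IsHomMulSystem S) :
    (extSystem F S).HasRightCalculusOfFractions where
  toIsMultiplicative := ext_mult F
  exists_rightFraction X Y p := by
    obtain ⟨f, q, hq⟩ := p
    obtain ⟨k, s, hs, e, rfl⟩ := ext_TR F hC hS q hq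
    refine ⟨⟨tau (F.map s ≫ η F) X, ext_tau F s hs X, f ▷ F.obj k ≫ e.inv⟩, ?_⟩
    simp [tau_nat]
  ext X Y Y' f₁ f₂ q hq h := by
    obtain ⟨k, s, hs, e, rfl⟩ := ext_TR F hC hS q hq
    refine ⟨_, tau (F.map s ≫ η F) X, ext_tau F s hs X, ?_⟩
    obtain ⟨K', ⟨i⟩⟩ := inv_obj F hC k
    obtain ⟨c, hc⟩ := tau_swap i (F.map s ≫ η F) Y'
    rw [← cancel_mono e.hom, Category.assoc, Category.assoc, tau_nat, tau_nat, hc]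
    simp only [← Category.assoc, ← comp_whiskerRight] at h ⊢
    rw [h]

end Main

/-- **Statement 16.** Let `S` be a homogeneous multiplicative system in a graded
commutative 2-ring `C` and let `F : C ⥤ A` be an algebra over it (an additive
symmetric monoidal functor to a preadditive symmetric monoidal category `A` with
tensor additive in each variable).  Then the extension `S_A` of `S` to `A` satisfies
both a left and a right calculus of fractions in `A`. -/
theorem extSystem_hasCalculusOfFractions
    {C : Type u} [Category.{v} C] [Preadditive C] [MonoidalCategory C]
    [SymmetricCategory C] [MonoidalPreadditive C] [GradedComm2Ring C]
    {A : Type u'} [Category.{v'} A] [Preadditive A] [MonoidalCategory A]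
    [SymmetricCategory A] [MonoidalPreadditive A]
    (S : MorphismProperty C) (hS : IsHomMulSystem S)
    (F : C ⥤ A) [F.Additive] [F.Monoidal] [F.Braided] :
    (extSystem F S).HasLeftCalculusOfFractions ∧
    (extSystem F S).HasRightCalculusOfFractions := by
  exact ⟨ext_left F GradedComm2Ring.invertible hS, ext_right F GradedComm2Ring.invertible hS⟩
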